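/- Let g be a finite-dimensional semisimple Lie algebra over the complex numbers and let N ≥ 3 be an integer. Then every N-derivation of g is an inner derivation: for every N-derivation φ of g there exists x ∈ g such that φ = ad(x), i.e., φ(y) = [x, y] for all y ∈ g. -/

import Mathlib

open scoped BigOperators

/-- Right-iterated Lie bracket `[x₁, x₂, …, xₖ] = [x₁, [x₂, [… [x_{k-1}, xₖ] …]]]`. -/
def itBracket {L : Type*} [LieRing L] : List L → L
  | [] => 0
  | [a] => a
  | a :: b :: l => ⁅a, itBracket (b :: l)⁆

/-- `φ` is an `N`-derivation of the Lie algebra `L`: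
`φ [x₁, …, x_N] = ∑ i, [x₁, …, x_{i-1}, φ xᵢ, x_{i+1}, …, x_N]`. -/
def IsNDeriv (F : Type*) {L : Type*} [CommRing F] [LieRing L] [LieAlgebra F L]
    (N : ℕ) (φ : L →ₗ[F] L) : Prop :=
  ∀ x : Fin N → L,
    φ (itBracket (List.ofFn x)) =
      ∑ i : Fin N, itBracket (List.ofFn (Function.update x i (φ (x i))))

section NDerivation

open LieAlgebra TrivSqZeroExt

variable {K L : Type*} [Field K] [LieRing L] [LieAlgebra K L]

lemma itBracket_cons_ofFn {n : ℕ} (a : L) (x : Fin (n + 1) → L) :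
    itBracket (a :: List.ofFn x) = ⁅a, itBracket (List.ofFn x)⁆ := by
  rw [List.ofFn_succ]
  rfl

/-- The defect `x ↦ [φ, ad x] - ad (φ x)` of `φ` from being a derivation. -/
noncomputable def derivDefect (φ : L →ₗ[K] L) : L →ₗ[K] Module.End K L :=
  LinearMap.mulLeft K φ ∘ₗ (ad K L : L →ₗ[K] Module.End K L)
    - LinearMap.mulRight K φ ∘ₗ (ad K L : L →ₗ[K] Module.End K L)
    - (ad K L : L →ₗ[K] Module.End K L) ∘ₗ φ

@[simp] lemma derivDefect_apply (φ : L →ₗ[K] L) (x y : L) :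
    derivDefect φ x y = φ ⁅x, y⁆ - ⁅x, φ y⁆ - ⁅φ x, y⁆ := by
  simp [derivDefect]

/-- The first-order deformation `ad x + ε (derivDefect φ x)` of the adjoint action. -/
noncomputable def adDeform (φ : L →ₗ[K] L) : L →ₗ[K] DualNumber (Module.End K L) :=
  LinearMap.prod (ad K L : L →ₗ[K] Module.End K L) (derivDefect φ)

@[simp] lemma fst_adDeform (φ : L →ₗ[K] L) (x : L) : (adDeform φ x).fst = ad K L x := rfl

@[simp] lemma snd_adDeform (φ : L →ₗ[K] L) (x : L) : (adDeform φ x).snd = derivDefect φ x := rfl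

lemma fst_prod_adDeform_apply (φ : L →ₗ[K] L) {n : ℕ} (x : Fin (n + 1) → L) :
    (List.ofFn fun i : Fin n ↦ adDeform φ (x i.castSucc)).prod.fst (x (Fin.last n)) =
      itBracket (List.ofFn x) := by
  induction n with
  | zero => simp [itBracket]
  | succ n ih =>
    rw [List.ofFn_succ, List.prod_cons, List.ofFn_succ (f := x), itBracket_cons_ofFn, ← ih]
    simp

lemma sum_itBracket_update (φ : L →ₗ[K] L) {n : ℕ} (x : Fin (n + 1) → L) :
    ∑ i, itBracket (List.ofFn (Function.update x i (φ (x i)))) =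
      φ (itBracket (List.ofFn x)) -
        (List.ofFn fun i : Fin n ↦ adDeform φ (x i.castSucc)).prod.snd (x (Fin.last n)) := by
  induction n with
  | zero => simp [itBracket]
  | succ n ih =>
    have hfst := fst_prod_adDeform_apply φ (fun i ↦ x i.succ)
    have hsnd := ih (fun i ↦ x i.succ)
    have hzero : itBracket (List.ofFn (Function.update x 0 (φ (x 0)))) =
        ⁅φ (x 0), itBracket (List.ofFn fun i ↦ x i.succ)⁆ := by
      rw [List.ofFn_succ, itBracket_cons_ofFn]
      simp [Function.update_of_ne, Fin.succ_ne_zero]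
    have hsucc (j : Fin (n + 1)) :
        itBracket (List.ofFn (Function.update x j.succ (φ (x j.succ)))) =
        ⁅x 0, itBracket (List.ofFn (Function.update (fun i ↦ x i.succ) j (φ (x j.succ))))⁆ := by
      rw [List.ofFn_succ, itBracket_cons_ofFn, Function.update_of_ne (Fin.succ_ne_zero j).symm]
      congr 3
      ext i
      simp [Function.update_apply]
    rw [Fin.sum_univ_succ, hzero, Finset.sum_congr rfl fun j _ ↦ hsucc j, ← lie_sum, hsnd,
      List.ofFn_succ (f := x), itBracket_cons_ofFn,
      List.ofFn_succ (f := fun i : Fin (n + 1) ↦ adDeform φ (x i.castSucc)), List.prod_cons]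
    simp only [Fin.castSucc_zero, ← Fin.succ_castSucc, ← Fin.succ_last, snd_mul, fst_adDeform,
      snd_adDeform, smul_eq_mul, MulOpposite.smul_eq_mul_unop, MulOpposite.unop_op,
      LinearMap.add_apply, Module.End.mul_apply, hfst, ad_apply, derivDefect_apply, lie_sub]
    abel

lemma IsNDeriv.snd_eq_zero_of_mem_pow {φ : L →ₗ[K] L} {n : ℕ} (hφ : IsNDeriv K (n + 1) φ)
    {s : DualNumber (Module.End K L)} (hs : s ∈ (adDeform φ).range ^ n) : s.snd = 0 := by
  rw [Submodule.pow_eq_span_pow_set] at hs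
  induction hs using Submodule.span_induction with
  | mem s hs =>
    obtain ⟨f, rfl⟩ := Set.mem_pow.mp hs
    choose x hx using fun i ↦ (f i).2
    ext y
    have h := sum_itBracket_update φ (Fin.snoc x y : Fin (n + 1) → L)
    rw [← hφ, eq_comm, sub_eq_self] at h
    simpa [hx] using h
  | zero => simp
  | add s t _ _ hs ht => simp [hs, ht]
  | smul c s _ hs => simp [hs]

lemma IsNDeriv.snd_eq_zero_of_mem_pow_two_mul {φ : L →ₗ[K] L} {n : ℕ}
    (hφ : IsNDeriv K (n + 1) φ) {s : DualNumber (Module.End K L)}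
    (hs : s ∈ (adDeform φ).range ^ (2 * n)) : s.snd = 0 := by
  rw [two_mul, pow_add] at hs
  induction hs using Submodule.mul_induction_on' with
  | mem_mul_mem s hs t ht =>
    simp [hφ.snd_eq_zero_of_mem_pow hs, hφ.snd_eq_zero_of_mem_pow ht]
  | add s _ t _ hs ht => simp [hs, ht]

lemma ad_lie_eq_mul_sub_mul (x y : L) :
    ad K L ⁅x, y⁆ = ad K L x * ad K L y - ad K L y * ad K L x := by
  ext z
  simp

variable [IsKilling K L]

/-- The Casimir element of the Killing form acts as the identity in the adjoint representation. -/
lemma sum_ad_dualBasis_mul_ad {ι : Type*} [Fintype ι] [DecidableEq ι] (b : Module.Basis ι K L) :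
    ∑ i, ad K L ((killingForm K L).dualBasis (IsKilling.killingForm_nondegenerate K L) b i) *
      ad K L (b i) = 1 := by
  set κ := killingForm K L
  have hκ : κ.Nondegenerate := IsKilling.killingForm_nondegenerate K L
  set d := κ.dualBasis hκ b
  have hrepr (y : L) (i : ι) : b.repr y i = κ (d i) y := by
    conv_rhs => rw [← b.sum_repr y]
    simp only [map_sum, map_smul, d, LinearMap.BilinForm.apply_dualBasis_left]
    simp
  have htrace (T : Module.End K L) : LinearMap.trace K L T = ∑ i, κ (d i) (T (b i)) := by
    simp [LinearMap.trace_eq_matrix_trace K b, Matrix.trace, LinearMap.toMatrix_apply, hrepr]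
  have hinv (x y z : L) : κ ⁅x, y⁆ z = κ x ⁅y, z⁆ := LieModule.traceForm_apply_lie_apply K L L x y z
  have hcomm (x y : L) : κ x y = κ y x := LieModule.traceForm_comm K L L x y
  ext x
  rw [← sub_eq_zero]
  refine hκ.1 _ fun y ↦ ?_
  rw [map_sub, LinearMap.sub_apply, sub_eq_zero]
  have hxy : κ x y = ∑ i, κ (d i) ⁅y, ⁅x, b i⁆⁆ := by
    rw [hcomm, killingForm_apply_apply, htrace]
    simp
  simp only [LinearMap.sum_apply, Module.End.mul_apply, ad_apply, map_sum, Module.End.one_apply]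
  rw [hxy]
  refine Finset.sum_congr rfl fun i _ ↦ ?_
  rw [hinv, ← lie_skew ⁅b i, x⁆ y, ← lie_skew (b i) x, lie_neg, neg_neg]

variable [FiniteDimensional K L]

lemma range_ad_le_sq :
    (ad K L : L →ₗ[K] Module.End K L).range ≤ (ad K L : L →ₗ[K] Module.End K L).range ^ 2 := by
  classical
  rintro - ⟨y, rfl⟩
  have h := LinearMap.congr_fun (sum_ad_dualBasis_mul_ad (Module.finBasis K L)) y
  rw [Module.End.one_apply] at h
  rw [← h, LinearMap.sum_apply, map_sum]
  refine Submodule.sum_mem _ fun i _ ↦ ?_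
  simp only [Module.End.mul_apply, ad_apply, LieHom.coe_toLinearMap, ad_lie_eq_mul_sub_mul, pow_two]
  rw [← ad_lie_eq_mul_sub_mul]
  exact Submodule.sub_mem _ (Submodule.mul_mem_mul ⟨_, rfl⟩ ⟨_, rfl⟩)
    (Submodule.mul_mem_mul ⟨_, rfl⟩ ⟨_, rfl⟩)

lemma one_mem_range_ad_pow {n : ℕ} (hn : 2 ≤ n) :
    (1 : Module.End K L) ∈ (ad K L : L →ₗ[K] Module.End K L).range ^ n := by
  classical
  induction n, hn using Nat.le_induction with
  | base =>
    rw [← sum_ad_dualBasis_mul_ad (Module.finBasis K L), pow_two]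
    exact Submodule.sum_mem _ fun i _ ↦ Submodule.mul_mem_mul ⟨_, rfl⟩ ⟨_, rfl⟩
  | succ n hn ih =>
    obtain ⟨m, rfl⟩ : ∃ m, n = m + 1 := ⟨n - 1, by omega⟩
    rw [add_assoc, pow_add]
    rw [pow_add, pow_one] at ih
    exact mul_le_mul' le_rfl range_ad_le_sq ih

lemma IsNDeriv.derivDefect_eq_zero [CharZero K] {φ : L →ₗ[K] L} {n : ℕ} (hn : 2 ≤ n)
    (hφ : IsNDeriv K (n + 1) φ) : derivDefect φ = 0 := by
  classical
  obtain ⟨s, hs, hs1⟩ : ∃ s ∈ (adDeform φ).range ^ (2 * n - 1), s.fst = 1 := by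
    have h := one_mem_range_ad_pow (K := K) (L := L) (n := 2 * n - 1) (by omega)
    have hmap : (adDeform φ).range.map
        (fstHom K (Module.End K L) (Module.End K L)).toLinearMap =
        (ad K L : L →ₗ[K] Module.End K L).range := by
      rw [← LinearMap.range_comp]
      rfl
    rw [← hmap, ← Submodule.map_pow] at h
    exact h
  set z := s.snd
  have hpow : 2 * n = 2 * n - 1 + 1 := by omega
  have hright (x : L) : derivDefect φ x = -(ad K L x * z) := by
    have h : adDeform φ x * s ∈ (adDeform φ).range ^ (2 * n) := by
      rw [hpow, pow_succ']
      exact Submodule.mul_mem_mul ⟨x, rfl⟩ hs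
    have h0 := hφ.snd_eq_zero_of_mem_pow_two_mul h
    rw [snd_mul, hs1] at h0
    simpa [add_comm] using eq_neg_of_add_eq_zero_right h0
  have hleft (x : L) : derivDefect φ x = -(z * ad K L x) := by
    have h : s * adDeform φ x ∈ (adDeform φ).range ^ (2 * n) := by
      rw [hpow, pow_succ]
      exact Submodule.mul_mem_mul hs ⟨x, rfl⟩
    have h0 := hφ.snd_eq_zero_of_mem_pow_two_mul h
    rw [snd_mul, hs1] at h0
    simpa using eq_neg_of_add_eq_zero_left h0
  let b := Module.finBasis K L
  let d := (killingForm K L).dualBasis (IsKilling.killingForm_nondegenerate K L) b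
  have hC : ∑ i, ad K L (d i) * ad K L (b i) = 1 := sum_ad_dualBasis_mul_ad b
  set C := ∑ i, adDeform φ (d i) * adDeform φ (b i)
  have hC1 : C.fst = 1 := by simpa only [C, fst_sum, fst_mul, fst_adDeform] using hC
  have hC2 : C.snd = -(2 : K) • z := by
    have h (i) : (adDeform φ (d i) * adDeform φ (b i)).snd =
        -(ad K L (d i) * ad K L (b i) * z) - z * (ad K L (d i) * ad K L (b i)) := by
      rw [snd_mul, snd_adDeform, snd_adDeform, hright (b i), hleft (d i)]
      simp [mul_assoc, sub_eq_add_neg]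
    rw [snd_sum, Finset.sum_congr rfl fun i _ ↦ h i, Finset.sum_sub_distrib,
      Finset.sum_neg_distrib, ← Finset.sum_mul, ← Finset.mul_sum, hC, one_mul, mul_one,
      neg_smul, two_smul, neg_add, sub_eq_add_neg]
  have hCn : (C ^ n).snd = 0 := by
    refine hφ.snd_eq_zero_of_mem_pow_two_mul ?_
    rw [pow_mul]
    refine Submodule.pow_mem_pow _ ?_ n
    rw [pow_two]
    exact Submodule.sum_mem _ fun i _ ↦ Submodule.mul_mem_mul ⟨_, rfl⟩ ⟨_, rfl⟩
  rw [snd_pow_of_smul_comm _ _ (by simp [hC1]), hC1, hC2] at hCn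
  have hz0 : z = 0 := by
    have hn0 : n ≠ 0 := by omega
    simpa [← Nat.cast_smul_eq_nsmul K, hn0] using hCn
  ext1 x
  simp [hright x, hz0]

/-- An `N`-derivation, `N ≥ 3`, of a Lie algebra with nondegenerate Killing form is inner. -/
theorem IsNDeriv.exists_eq_lie [CharZero K] {φ : L →ₗ[K] L} {N : ℕ} (hN : 3 ≤ N)
    (hφ : IsNDeriv K N φ) : ∃ x : L, ∀ y : L, φ y = ⁅x, y⁆ := by
  obtain ⟨n, rfl⟩ : ∃ n, N = n + 1 := ⟨N - 1, by omega⟩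
  have h := hφ.derivDefect_eq_zero (by omega)
  let D : LieDerivation K L L :=
    { toLinearMap := φ
      leibniz' := fun a b ↦ by
        have hab := LinearMap.congr_fun (LinearMap.congr_fun h a) b
        rw [derivDefect_apply, LinearMap.zero_apply, LinearMap.zero_apply, sub_sub,
          sub_eq_zero] at hab
        rw [hab, ← lie_skew (φ a) b, sub_eq_add_neg] }
  obtain ⟨x, hx⟩ := LieDerivation.IsKilling.exists_eq_ad D
  refine ⟨x, fun y ↦ ?_⟩
  simpa [D] using (LieDerivation.congr_fun hx y).symm

end NDerivation

/-- Every `N`-derivation (`N ≥ 3`) of a finite-dimensional semisimple complex Lie algebra is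
an inner derivation `ad x : y ↦ [x, y]`. -/
theorem nDeriv_semisimple_isInner (g : Type*) [LieRing g] [LieAlgebra ℂ g]
    [FiniteDimensional ℂ g] [LieAlgebra.IsSemisimple ℂ g]
    (N : ℕ) (hN : 3 ≤ N) (φ : g →ₗ[ℂ] g) (hφ : IsNDeriv ℂ N φ) :
    ∃ x : g, ∀ y : g, φ y = ⁅x, y⁆ := by
  exact hφ.exists_eq_lie hN
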